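/- Suppose 0 = Y_0, Y_1, …, Y_m is a martingale such that −c ≤ Y_i − Y_{i−1} ≤ C for all 1 ≤ i ≤ m, where c, C > 0 are real numbers with c ≤ C/10. Then for every a with 0 < a < c·m, one has Pr(|Y_m| ≥ a) ≤ 2·exp(−a²/(3·c·C·m)). -/

import Mathlib

open MeasureTheory Filter

theorem exp_le_one_add_add_sq {x : ℝ} (hx : |x| ≤ 2 / 3) :
    Real.exp x ≤ 1 + x + 3 / 4 * x ^ 2 := by
  have h := (abs_le.mp (Real.exp_bound (x := x) (by linarith) (n := 3) (by norm_num))).2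
  norm_num [Finset.sum_range_succ, Nat.factorial] at h
  have h3 : |x| ^ 3 ≤ 2 / 3 * x ^ 2 := by
    rw [pow_succ, sq_abs, mul_comm]
    exact mul_le_mul_of_nonneg_right hx (sq_nonneg x)
  nlinarith [sq_nonneg x]

theorem exp_mul_le_affine {c C t x : ℝ} (hcC : c ≤ C) (ht : |t| * C ≤ 2 / 3)
    (hx : -c ≤ x) (hx' : x ≤ C) :
    Real.exp (t * x) ≤ (1 + 3 / 4 * t ^ 2 * (c * C)) + (t + 3 / 4 * t ^ 2 * (C - c)) * x := by
  have hxC : |x| ≤ C := abs_le.mpr ⟨by linarith, hx'⟩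
  have h := exp_le_one_add_add_sq (x := t * x) <| by
    rw [abs_mul]
    exact (mul_le_mul_of_nonneg_left hxC (abs_nonneg t)).trans ht
  nlinarith [mul_nonneg (sq_nonneg t) (mul_nonneg (sub_nonneg.mpr hx) (sub_nonneg.mpr hx'))]

/-- Multiplying by a bounded `m`-measurable function preserves conditional centering. -/
theorem integral_mul_eq_zero_of_condExp_eq_zero {Ω : Type*} {m mΩ : MeasurableSpace Ω}
    {μ : Measure Ω} [IsFiniteMeasure μ] (hm : m ≤ mΩ) {f g : Ω → ℝ}
    (hf : StronglyMeasurable[m] f) (hg : Integrable g μ) (hfg : Integrable (fun ω ↦ f ω * g ω) μ)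
    (hg0 : μ[g|m] =ᵐ[μ] 0) : ∫ ω, f ω * g ω ∂μ = 0 := by
  have h := condExp_mul_of_stronglyMeasurable_left hf hfg hg
  calc ∫ ω, f ω * g ω ∂μ = ∫ ω, (μ[f * g|m]) ω ∂μ := (integral_condExp hm).symm
    _ = ∫ _, (0 : ℝ) ∂μ := by
      refine integral_congr_ae ?_
      filter_upwards [h, hg0] with ω h1 h2
      simp [h1, h2]
    _ = 0 := by simp

/-- The moment generating function of a martingale with increments in `[-c, C]`. -/
theorem mgf_martingale_le {Ω : Type*} {mΩ : MeasurableSpace Ω} (μ : Measure Ω)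
    [IsProbabilityMeasure μ] (𝓕 : Filtration ℕ mΩ) (m : ℕ) (Y : ℕ → Ω → ℝ)
    (hadp : Adapted 𝓕 Y) (hint : ∀ i, Integrable (Y i) μ)
    (hY0 : ∀ ω, Y 0 ω = 0)
    (hmart : ∀ i < m, μ[Y (i + 1)|𝓕 i] =ᵐ[μ] Y i)
    {c C t : ℝ} (hcC : c ≤ C) (ht : |t| * C ≤ 2 / 3)
    (hbdd : ∀ i < m, ∀ ω, -c ≤ Y (i + 1) ω - Y i ω ∧ Y (i + 1) ω - Y i ω ≤ C) :
    ∀ i ≤ m, Integrable (fun ω ↦ Real.exp (t * Y i ω)) μ ∧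
      ProbabilityTheory.mgf (Y i) μ t ≤ Real.exp (3 / 4 * t ^ 2 * (c * C)) ^ i := by
  have hbound : ∀ i ≤ m, ∀ ω, |Y i ω| ≤ i * C := by
    intro i
    induction i with
    | zero => intro _ ω; simp [hY0]
    | succ i ih =>
      intro hi ω
      obtain ⟨h1, h2⟩ := hbdd i hi ω
      obtain ⟨h3, h4⟩ := abs_le.mp (ih (by omega) ω)
      push_cast
      exact abs_le.mpr ⟨by linarith, by linarith⟩
  have hsm : ∀ i, StronglyMeasurable[𝓕 i] (fun ω ↦ Real.exp (t * Y i ω)) := fun i ↦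
    ((Real.measurable_exp.comp ((hadp i).const_mul t))).stronglyMeasurable
  have hexp : ∀ i ≤ m, ∀ ω, ‖Real.exp (t * Y i ω)‖ ≤ Real.exp (|t| * (i * C)) := by
    intro i hi ω
    rw [Real.norm_eq_abs, Real.abs_exp, Real.exp_le_exp]
    calc t * Y i ω ≤ |t * Y i ω| := le_abs_self _
      _ = |t| * |Y i ω| := abs_mul _ _
      _ ≤ |t| * (i * C) := mul_le_mul_of_nonneg_left (hbound i hi ω) (abs_nonneg t)
  have hinte : ∀ i ≤ m, Integrable (fun ω ↦ Real.exp (t * Y i ω)) μ := fun i hi ↦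
    Integrable.of_bound ((hsm i).mono (𝓕.le i)).aestronglyMeasurable _
      (Eventually.of_forall (hexp i hi))
  intro i hi
  refine ⟨hinte i hi, ?_⟩
  induction i with
  | zero => simp [ProbabilityTheory.mgf, hY0]
  | succ i ih =>
    have him : i ≤ m := by omega
    set A := 1 + 3 / 4 * t ^ 2 * (c * C)
    set B := t + 3 / 4 * t ^ 2 * (C - c)
    have hX : Integrable (Y (i + 1) - Y i) μ := (hint _).sub (hint _)
    have hprod : Integrable (fun ω ↦ Real.exp (t * Y i ω) * (Y (i + 1) - Y i) ω) μ :=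
      hX.bdd_mul ((hsm i).mono (𝓕.le i)).aestronglyMeasurable
        (Eventually.of_forall (hexp i him))
    have hcond : μ[Y (i + 1) - Y i|𝓕 i] =ᵐ[μ] 0 := by
      filter_upwards [condExp_sub (hint (i + 1)) (hint i) (𝓕 i), hmart i hi] with ω h1 h2
      rw [h1, Pi.sub_apply, h2,
        condExp_of_stronglyMeasurable (𝓕.le i) (hadp i).stronglyMeasurable (hint i)]
      simp
    have hzero := integral_mul_eq_zero_of_condExp_eq_zero (𝓕.le i) (hsm i) hX hprod hcond
    have hA : A ≤ Real.exp (3 / 4 * t ^ 2 * (c * C)) := by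
      simpa only [A, add_comm] using Real.add_one_le_exp (3 / 4 * t ^ 2 * (c * C))
    calc ∫ ω, Real.exp (t * Y (i + 1) ω) ∂μ
        ≤ ∫ ω, (A * Real.exp (t * Y i ω)
            + B * (Real.exp (t * Y i ω) * (Y (i + 1) - Y i) ω)) ∂μ := by
          refine integral_mono (hinte _ hi) (((hinte i him).const_mul A).add
            (hprod.const_mul B)) fun ω ↦ ?_
          have h := exp_mul_le_affine hcC ht (hbdd i hi ω).1 (hbdd i hi ω).2
          have hsplit : t * Y (i + 1) ω = t * Y i ω + t * (Y (i + 1) ω - Y i ω) := by ring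
          simp only [hsplit, Real.exp_add, Pi.sub_apply]
          calc _ ≤ Real.exp (t * Y i ω) * (A + B * (Y (i + 1) ω - Y i ω)) :=
                mul_le_mul_of_nonneg_left h (Real.exp_pos _).le
            _ = _ := by ring
      _ = A * ∫ ω, Real.exp (t * Y i ω) ∂μ := by
          rw [integral_add ((hinte i him).const_mul A) (hprod.const_mul B),
            integral_const_mul, integral_const_mul, hzero]
          ring
      _ ≤ Real.exp (3 / 4 * t ^ 2 * (c * C)) * Real.exp (3 / 4 * t ^ 2 * (c * C)) ^ i :=
          mul_le_mul hA (ih him) (integral_nonneg fun ω ↦ (Real.exp_pos _).le)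
            (Real.exp_pos _).le
      _ = _ := (pow_succ' _ _).symm

/-- Bohman's asymmetric Hoeffding-type inequality.
If `0 = Y_0, Y_1, …, Y_m` is a martingale with `-c ≤ Y_i - Y_{i-1} ≤ C` for all
`1 ≤ i ≤ m`, where `0 < c ≤ C/10`, then for every `0 < a < c·m` we have
`Pr(|Y_m| ≥ a) ≤ 2 exp(-a²/(3cCm))`. -/
theorem statement10 {Ω : Type*} {mΩ : MeasurableSpace Ω} (μ : Measure Ω)
    [IsProbabilityMeasure μ] (𝓕 : Filtration ℕ mΩ) (m : ℕ) (Y : ℕ → Ω → ℝ)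
    (hadp : Adapted 𝓕 Y) (hint : ∀ i, Integrable (Y i) μ)
    (hY0 : ∀ ω, Y 0 ω = 0)
    (hmart : ∀ i < m, μ[Y (i + 1)|𝓕 i] =ᵐ[μ] Y i)
    (c C : ℝ) (hc : 0 < c) (hC : 0 < C) (hcC : c ≤ C / 10)
    (hbdd : ∀ i, 1 ≤ i → i ≤ m → ∀ ω,
      -c ≤ Y i ω - Y (i - 1) ω ∧ Y i ω - Y (i - 1) ω ≤ C)
    (a : ℝ) (ha : 0 < a) (ham : a < c * m) :
    μ {ω | a ≤ |Y m ω|} ≤ ENNReal.ofReal (2 * Real.exp (-a ^ 2 / (3 * c * C * m))) := by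
  have hm : (0 : ℝ) < m := pos_of_mul_pos_right (ha.trans ham) hc.le
  set t := 2 * a / (3 * c * C * m) with ht_def
  have ht : 0 ≤ t := by positivity
  have htC : |t| * C ≤ 2 / 3 := by
    rw [abs_of_nonneg ht, ht_def, div_mul_eq_mul_div, div_le_iff₀ (by positivity)]
    nlinarith
  have hstep : ∀ i < m, ∀ ω, -c ≤ Y (i + 1) ω - Y i ω ∧ Y (i + 1) ω - Y i ω ≤ C :=
    fun i hi ω ↦ hbdd (i + 1) (by omega) hi ω
  have hexponent : Real.exp (-t * a) * Real.exp (3 / 4 * t ^ 2 * (c * C)) ^ m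
      = Real.exp (-a ^ 2 / (3 * c * C * m)) := by
    rw [← Real.exp_nat_mul, ← Real.exp_add, ht_def]
    congr 1
    field_simp
    ring
  obtain ⟨hi₁, h₁⟩ := mgf_martingale_le μ 𝓕 m Y hadp hint hY0 hmart (by linarith) htC hstep
    m le_rfl
  obtain ⟨hi₂, h₂⟩ := mgf_martingale_le μ 𝓕 m Y hadp hint hY0 hmart (t := -t) (by linarith)
    (by rwa [abs_neg]) hstep m le_rfl
  have hupper : μ.real {ω | a ≤ Y m ω} ≤ Real.exp (-a ^ 2 / (3 * c * C * m)) :=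
    hexponent ▸ (ProbabilityTheory.measure_ge_le_exp_mul_mgf a ht hi₁).trans
      (mul_le_mul_of_nonneg_left h₁ (Real.exp_pos _).le)
  have hlower : μ.real {ω | Y m ω ≤ -a} ≤ Real.exp (-a ^ 2 / (3 * c * C * m)) := by
    have h := (ProbabilityTheory.measure_le_le_exp_mul_mgf (-a) (neg_nonpos.mpr ht) hi₂).trans
      (mul_le_mul_of_nonneg_left h₂ (Real.exp_pos _).le)
    rwa [neg_sq, neg_neg, mul_neg, ← neg_mul, hexponent] at h
  have hset : {ω | a ≤ |Y m ω|} = {ω | a ≤ Y m ω} ∪ {ω | Y m ω ≤ -a} := by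
    ext ω
    simp [le_abs, le_neg]
  rw [← ofReal_measureReal]
  refine ENNReal.ofReal_le_ofReal ?_
  rw [hset]
  linarith [measureReal_union_le (μ := μ) {ω | a ≤ Y m ω} {ω | Y m ω ≤ -a}]
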